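/- arXiv:1011.6204 — 2 statements merged into one kernel-verified Lean document; each statement's English description precedes it below -/
import Mathlib

section
/- Let k ∈ \bar{ℕ}^ℓ and let r be the least integer ≥ 0 with k_{r+1} = ∞ (convention k_{ℓ+1} = ∞, so r ≤ ℓ). Set Λ_k := {p_{r+1}(u) : u ∈ ℕ^ℓ, π_r(u) = π_r(k)} and A_{Λ_k} := {f ∈ E : f ≥ e for some e ∈ Λ_k}. Then A_{Λ_k} is a filter in E, and its indicator function is given by the closed formula: for 1 ≤ i ≤ ℓ, p_i(m) ∈ A_{Λ_k} if and only if π_{i−1}(m) = π_{i−1}(k) and m_i ≤ k_i; and p_{ℓ+1}(m) ∈ A_{Λ_k} if and only if m = k (in particular all coordinates of k are finite). -/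
open scoped BigOperators

noncomputable section

/-- The Hilbert space `H = ℓ²(ℕ^ℓ × ℤ)`. -/
abbrev H (ℓ : ℕ) : Type := lp (fun _ : (Fin ℓ → ℕ) × ℤ => ℂ) 2

/-- The standard basis vector `e_{(a,z)}` of `H`. -/
noncomputable def basisVec (ℓ : ℕ) (a : Fin ℓ → ℕ) (z : ℤ) : H ℓ :=
  lp.single 2 (a, z) 1

/-- `IsBop ℓ B` says that for each `i : Fin (ℓ+1)`, `r : ℤ` and `m n : Fin ℓ → ℕ`,
`B i r m n` is the operator `B_{i+1}(r,m,n)` of the paper (paper index `i ∈ {1,…,ℓ+1}`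
is `i-1 : Fin (ℓ+1)` here).  For `k : Fin ℓ` (paper index `k+1 ≤ ℓ`) :
`B k r m n e_{(a,z)} = e_{(a',z+Σ_{j≤k}(m_j−n_j))}` if `a_j = n_j` for `j < k` and
`a_k ≥ n_k` (where `a'_j = m_j` for `j < k`, `a'_k = a_k − n_k + m_k`, `a'_j = a_j`
for `j > k`), and `= 0` otherwise; and
`B ℓ r m n e_{(a,z)} = e_{(m, z + r + Σ_j (m_j − n_j))}` if `a = n`, and `= 0` otherwise. -/
def IsBop (ℓ : ℕ)
    (B : Fin (ℓ + 1) → ℤ → (Fin ℓ → ℕ) → (Fin ℓ → ℕ) → (H ℓ →L[ℂ] H ℓ)) : Prop :=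
  (∀ (k : Fin ℓ) (r : ℤ) (m n : Fin ℓ → ℕ) (a : Fin ℓ → ℕ) (z : ℤ),
      B k.castSucc r m n (basisVec ℓ a z) =
        if (∀ j : Fin ℓ, j < k → a j = n j) ∧ n k ≤ a k then
          basisVec ℓ
            (fun j => if j < k then m j else if j = k then a k - n k + m k else a j)
            (z + ∑ j ∈ Finset.univ.filter (fun j : Fin ℓ => j ≤ k), ((m j : ℤ) - (n j : ℤ)))
        else 0) ∧
  (∀ (r : ℤ) (m n : Fin ℓ → ℕ) (a : Fin ℓ → ℕ) (z : ℤ),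
      B (Fin.last ℓ) r m n (basisVec ℓ a z) =
        if a = n then basisVec ℓ m (z + r + ∑ j, ((m j : ℤ) - (n j : ℤ))) else 0)

/-- The set of projections `E = {0} ∪ {p_i(m)}`, where `p_i(m) = B_i(0,m,m)`. -/
def Eset (ℓ : ℕ)
    (B : Fin (ℓ + 1) → ℤ → (Fin ℓ → ℕ) → (Fin ℓ → ℕ) → (H ℓ →L[ℂ] H ℓ)) :
    Set (H ℓ →L[ℂ] H ℓ) :=
  {0} ∪ {x | ∃ (i : Fin (ℓ + 1)) (m : Fin ℓ → ℕ), x = B i 0 m m}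

/-- A filter in `E`: a nonempty subset `A ⊆ E` with `0 ∉ A`, closed under (operator)
multiplication, and upward closed in `E` for the usual (Loewner) order on operators. -/
def IsFilterIn (ℓ : ℕ)
    (B : Fin (ℓ + 1) → ℤ → (Fin ℓ → ℕ) → (Fin ℓ → ℕ) → (H ℓ →L[ℂ] H ℓ))
    (A : Set (H ℓ →L[ℂ] H ℓ)) : Prop :=
  A.Nonempty ∧ A ⊆ Eset ℓ B ∧ (0 : H ℓ →L[ℂ] H ℓ) ∉ A ∧
    (∀ e ∈ A, ∀ f ∈ A, e * f ∈ A) ∧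
    (∀ e ∈ A, ∀ f ∈ Eset ℓ B, e ≤ f → f ∈ A)

/-- An ultrafilter in `E`: a filter maximal under inclusion. -/
def IsUltrafilterIn (ℓ : ℕ)
    (B : Fin (ℓ + 1) → ℤ → (Fin ℓ → ℕ) → (Fin ℓ → ℕ) → (H ℓ →L[ℂ] H ℓ))
    (A : Set (H ℓ →L[ℂ] H ℓ)) : Prop :=
  IsFilterIn ℓ B A ∧ ∀ A' : Set (H ℓ →L[ℂ] H ℓ), IsFilterIn ℓ B A' → A ⊆ A' → A' = A

/-- A character of `E`: a nonzero multiplicative map `E → {0,1}` (valued in `Bool`,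
with `&&` as multiplication) vanishing at `0`. -/
def IsCharacter (ℓ : ℕ)
    (B : Fin (ℓ + 1) → ℤ → (Fin ℓ → ℕ) → (Fin ℓ → ℕ) → (H ℓ →L[ℂ] H ℓ))
    (x : {e : H ℓ →L[ℂ] H ℓ // e ∈ Eset ℓ B} → Bool) : Prop :=
  (∃ e, x e = true) ∧
    (∀ (e f : {e : H ℓ →L[ℂ] H ℓ // e ∈ Eset ℓ B}) (h : e.val * f.val ∈ Eset ℓ B),
      x ⟨e.val * f.val, h⟩ = (x e && x f)) ∧
    (∀ h : (0 : H ℓ →L[ℂ] H ℓ) ∈ Eset ℓ B, x ⟨0, h⟩ = false)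

/-- `LeastInf ℓ k r` says that `r` is the least nonnegative integer such that
`k_{r+1} = ∞` (paper indexing, with the convention `k_{ℓ+1} = ∞`).  In the 0-indexed
formulation: `r ≤ ℓ`, `k r = ∞` if `r < ℓ`, and `k j ≠ ∞` for all `j < r`. -/
def LeastInf (ℓ : ℕ) (k : Fin ℓ → ℕ∞) (r : ℕ) : Prop :=
  r ≤ ℓ ∧ (∀ h : r < ℓ, k ⟨r, h⟩ = ⊤) ∧ ∀ j : Fin ℓ, (j : ℕ) < r → k j ≠ ⊤

/-- The support of the character `φ(k)`, `k ∈ ℕ̄^ℓ`: it contains `p_i(m)` (paper index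
`i ≤ ℓ`) iff `π_{i−1}(m) = π_{i−1}(k)` and `m_i ≤ k_i`, and `p_{ℓ+1}(m)` iff `m = k`. -/
def phiSupp (ℓ : ℕ)
    (B : Fin (ℓ + 1) → ℤ → (Fin ℓ → ℕ) → (Fin ℓ → ℕ) → (H ℓ →L[ℂ] H ℓ))
    (k : Fin ℓ → ℕ∞) : Set (H ℓ →L[ℂ] H ℓ) :=
  {x | (∃ (i : Fin ℓ) (m : Fin ℓ → ℕ), x = B i.castSucc 0 m m ∧
          (∀ j : Fin ℓ, j < i → (m j : ℕ∞) = k j) ∧ (m i : ℕ∞) ≤ k i) ∨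
       (∃ m : Fin ℓ → ℕ, x = B (Fin.last ℓ) 0 m m ∧ ∀ j : Fin ℓ, (m j : ℕ∞) = k j)}

open Classical in
/-- The character `φ(k) : E → {0,1}` associated to `k ∈ ℕ̄^ℓ`. -/
noncomputable def phi (ℓ : ℕ)
    (B : Fin (ℓ + 1) → ℤ → (Fin ℓ → ℕ) → (Fin ℓ → ℕ) → (H ℓ →L[ℂ] H ℓ))
    (k : Fin ℓ → ℕ∞) : {e : H ℓ →L[ℂ] H ℓ // e ∈ Eset ℓ B} → Bool :=
  fun e => decide (e.val ∈ phiSupp ℓ B k)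

/-- `T` is the diagonal operator projecting onto the span of the `e_{(a,z)}` with `a ∈ S`. -/
def IsDiagProj {ℓ : ℕ} (T : H ℓ →L[ℂ] H ℓ) (S : Set (Fin ℓ → ℕ)) : Prop :=
  ∀ a z, (a ∈ S → T (basisVec ℓ a z) = basisVec ℓ a z) ∧ (a ∉ S → T (basisVec ℓ a z) = 0)

lemma ext_basisVec {ℓ : ℕ} {T T' : H ℓ →L[ℂ] H ℓ}
    (h : ∀ a z, T (basisVec ℓ a z) = T' (basisVec ℓ a z)) : T = T' := by
  refine lp.ext_continuousLinearMap (ENNReal.ofNat_ne_top (n := nat_lit 2)) fun i => ?_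
  ext
  simpa [basisVec] using congrArg (fun v : H ℓ => v _) (h i.1 i.2)

lemma inner_basisVec_left {ℓ : ℕ} (a : Fin ℓ → ℕ) (z : ℤ) (x : H ℓ) :
    inner ℂ (basisVec ℓ a z) x = x (a, z) := by
  rw [basisVec, lp.inner_single_left]
  simp

lemma inner_basisVec_self {ℓ : ℕ} (a : Fin ℓ → ℕ) (z : ℤ) :
    inner ℂ (basisVec ℓ a z) (basisVec ℓ a z) = 1 := by
  rw [inner_basisVec_left, basisVec, lp.single_apply_self]

lemma inner_basisVec_of_ne {ℓ : ℕ} {a b : Fin ℓ → ℕ} (h : a ≠ b) (z w : ℤ) :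
    inner ℂ (basisVec ℓ a z) (basisVec ℓ b w) = 0 := by
  rw [inner_basisVec_left, basisVec, lp.single_apply_ne]
  simp [h]

namespace IsDiagProj

variable {ℓ : ℕ} {T T' : H ℓ →L[ℂ] H ℓ} {S S' : Set (Fin ℓ → ℕ)}

lemma zero : IsDiagProj (0 : H ℓ →L[ℂ] H ℓ) ∅ := fun _ _ => by simp

lemma unique (h : IsDiagProj T S) (h' : IsDiagProj T' S) : T = T' := by
  refine ext_basisVec fun a z => ?_
  by_cases ha : a ∈ S
  · rw [(h a z).1 ha, (h' a z).1 ha]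
  · rw [(h a z).2 ha, (h' a z).2 ha]

lemma mul (h : IsDiagProj T S) (h' : IsDiagProj T' S') : IsDiagProj (T * T') (S ∩ S') := by
  refine fun a z => ⟨fun ha => ?_, fun ha => ?_⟩
  · rw [mul_apply_eq_comp, (h' a z).1 ha.2, (h a z).1 ha.1]
  · rw [mul_apply_eq_comp]
    by_cases hs : a ∈ S'
    · rw [(h' a z).1 hs, (h a z).2 fun hs' => ha ⟨hs', hs⟩]
    · rw [(h' a z).2 hs, map_zero]

lemma sub (h : IsDiagProj T S) (h' : IsDiagProj T' S') (hS : S' ⊆ S) :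
    IsDiagProj (T - T') (S \ S') := by
  refine fun a z => ⟨fun ha => ?_, fun ha => ?_⟩
  · rw [sub_apply, (h a z).1 ha.1, (h' a z).2 ha.2, sub_zero]
  · rw [sub_apply]
    by_cases hs : a ∈ S'
    · rw [(h a z).1 (hS hs), (h' a z).1 hs, sub_self]
    · rw [(h a z).2 fun hs' => ha ⟨hs', hs⟩, (h' a z).2 hs, sub_zero]

lemma inner_map_basisVec (h : IsDiagProj T S) (a b : Fin ℓ → ℕ) (z w : ℤ) :
    inner ℂ (T (basisVec ℓ a z)) (basisVec ℓ b w) =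
      inner ℂ (basisVec ℓ a z) (T (basisVec ℓ b w)) := by
  by_cases hab : a = b
  · subst hab
    by_cases ha : a ∈ S
    · rw [(h a z).1 ha, (h a w).1 ha]
    · rw [(h a z).2 ha, (h a w).2 ha, inner_zero_left, inner_zero_right]
  · have h0 := inner_basisVec_of_ne hab z w
    by_cases ha : a ∈ S <;> by_cases hb : b ∈ S <;>
      simp [(h a z).1, (h a z).2, (h b w).1, (h b w).2, ha, hb, h0]

lemma isStarProjection (h : IsDiagProj T S) : IsStarProjection T := by
  refine ⟨(Set.inter_self S ▸ h.mul h).unique h, ext_basisVec fun a z => lp.ext ?_⟩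
  funext ⟨b, w⟩
  rw [← inner_basisVec_left, ← inner_basisVec_left, ContinuousLinearMap.star_eq_adjoint,
    ContinuousLinearMap.adjoint_inner_right, h.inner_map_basisVec]

lemma le_iff (h : IsDiagProj T S) (h' : IsDiagProj T' S') : T ≤ T' ↔ S ⊆ S' := by
  refine ⟨fun hle a ha => by_contra fun ha' => ?_, fun hS => ?_⟩
  · have hpos := ((ContinuousLinearMap.le_def _ _).1 hle).re_inner_nonneg_right (basisVec ℓ a 0)
    rw [sub_apply, (h a 0).1 ha, (h' a 0).2 ha', zero_sub, inner_neg_right,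
      inner_basisVec_self] at hpos
    norm_num at hpos
  · exact (ContinuousLinearMap.le_def _ _).2
      (ContinuousLinearMap.IsPositive.of_isStarProjection (h'.sub h hS).isStarProjection)

end IsDiagProj

/-- The set of `a ∈ ℕ^ℓ` such that `p_i(m)` fixes the vectors `e_{(a,z)}`. -/
def projSupp {ℓ : ℕ} (i : Fin (ℓ + 1)) (m : Fin ℓ → ℕ) : Set (Fin ℓ → ℕ) :=
  {a | (∀ j : Fin ℓ, j.castSucc < i → a j = m j) ∧ ∀ j : Fin ℓ, j.castSucc = i → m j ≤ a j}

lemma self_mem_projSupp {ℓ : ℕ} (i : Fin (ℓ + 1)) (m : Fin ℓ → ℕ) : m ∈ projSupp i m :=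
  ⟨fun _ _ => rfl, fun _ _ => le_rfl⟩

lemma mem_projSupp_castSucc {ℓ : ℕ} {i : Fin ℓ} {m a : Fin ℓ → ℕ} :
    a ∈ projSupp i.castSucc m ↔ (∀ j < i, a j = m j) ∧ m i ≤ a i := by
  simp [projSupp]

lemma mem_projSupp_last {ℓ : ℕ} {m a : Fin ℓ → ℕ} : a ∈ projSupp (Fin.last ℓ) m ↔ a = m := by
  simp [projSupp, Fin.castSucc_lt_last, (Fin.castSucc_lt_last _).ne, funext_iff]

lemma IsBop.isDiagProj {ℓ : ℕ}
    {B : Fin (ℓ + 1) → ℤ → (Fin ℓ → ℕ) → (Fin ℓ → ℕ) → (H ℓ →L[ℂ] H ℓ)}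
    (hB : IsBop ℓ B) (i : Fin (ℓ + 1)) (m : Fin ℓ → ℕ) :
    IsDiagProj (B i 0 m m) (projSupp i m) := by
  intro a z
  induction i using Fin.lastCases with
  | last =>
    rw [mem_projSupp_last, hB.2]
    refine ⟨fun h => ?_, fun h => if_neg h⟩
    simp [h]
  | cast i =>
    rw [mem_projSupp_castSucc, hB.1]
    refine ⟨fun h => ?_, fun h => if_neg h⟩
    rw [if_pos h]
    congr 1
    · funext j
      split_ifs with h1 h2
      · exact (h.1 j h1).symm
      · rw [h2, Nat.sub_add_cancel h.2]
      · rfl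
    · simp

lemma projSupp_inter_self {ℓ : ℕ} {i : Fin (ℓ + 1)} {m n : Fin ℓ → ℕ}
    (h : ∀ j : Fin ℓ, j.castSucc < i → m j = n j) :
    projSupp i m ∩ projSupp i n = projSupp i (m ⊔ n) := by
  ext a
  simp only [projSupp, Set.mem_inter_iff, Set.mem_ofPred_eq, Pi.sup_apply, sup_le_iff]
  constructor
  · rintro ⟨⟨h1, h2⟩, h3, h4⟩
    exact ⟨fun j hj => by rw [← h j hj, sup_idem, h1 j hj], fun j hj => ⟨h2 j hj, h4 j hj⟩⟩
  · rintro ⟨h1, h2⟩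
    have h3 : ∀ j : Fin ℓ, j.castSucc < i → a j = m j := fun j hj => by
      rw [h1 j hj, ← h j hj, sup_idem]
    exact ⟨⟨h3, fun j hj => (h2 j hj).1⟩, fun j hj => (h3 j hj).trans (h j hj),
      fun j hj => (h2 j hj).2⟩

/-- `k` satisfies the inequalities defining `projSupp i m`, extended to `ℕ̄^ℓ`. -/
def PointMem {ℓ : ℕ} (k : Fin ℓ → ℕ∞) (i : Fin (ℓ + 1)) (m : Fin ℓ → ℕ) : Prop :=
  (∀ j : Fin ℓ, j.castSucc < i → (m j : ℕ∞) = k j) ∧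
    ∀ j : Fin ℓ, j.castSucc = i → (m j : ℕ∞) ≤ k j

lemma PointMem.projSupp_subset {ℓ : ℕ} {k : Fin ℓ → ℕ∞} {i j : Fin (ℓ + 1)} {m n : Fin ℓ → ℕ}
    (hm : PointMem k i m) (hn : PointMem k j n) (hij : i < j) :
    projSupp j n ⊆ projSupp i m := by
  refine fun a ha => ⟨fun t ht => ?_, fun t ht => ?_⟩
  · rw [ha.1 t (ht.trans hij), ← ENat.natCast_inj, hm.1 t ht, hn.1 t (ht.trans hij)]
  · rw [ha.1 t (ht ▸ hij), ← ENat.natCast_le_natCast, hn.1 t (ht ▸ hij)]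
    exact hm.2 t ht

lemma PointMem.sup {ℓ : ℕ} {k : Fin ℓ → ℕ∞} {i : Fin (ℓ + 1)} {m n : Fin ℓ → ℕ}
    (hm : PointMem k i m) (hn : PointMem k i n) : PointMem k i (m ⊔ n) := by
  refine ⟨fun t ht => ?_, fun t ht => ?_⟩
  · have h : m t = n t := by rw [← ENat.natCast_inj, hm.1 t ht, hn.1 t ht]
    rw [Pi.sup_apply, ← h, sup_idem, hm.1 t ht]
  · rcases max_choice (m t) (n t) with h | h
    · simpa [Pi.sup_apply, h] using hm.2 t ht
    · simpa [Pi.sup_apply, h] using hn.2 t ht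

lemma PointMem.exists_mul {ℓ : ℕ}
    {B : Fin (ℓ + 1) → ℤ → (Fin ℓ → ℕ) → (Fin ℓ → ℕ) → (H ℓ →L[ℂ] H ℓ)}
    (hB : IsBop ℓ B) {k : Fin ℓ → ℕ∞} {i j : Fin (ℓ + 1)} {m n : Fin ℓ → ℕ}
    (hm : PointMem k i m) (hn : PointMem k j n) :
    ∃ t u, PointMem k t u ∧ B i 0 m m * B j 0 n n = B t 0 u u := by
  have hd := (hB.isDiagProj i m).mul (hB.isDiagProj j n)
  rcases lt_trichotomy i j with hij | rfl | hij
  · rw [Set.inter_eq_right.2 (hm.projSupp_subset hn hij)] at hd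
    exact ⟨j, n, hn, hd.unique (hB.isDiagProj j n)⟩
  · rw [projSupp_inter_self fun t ht => by rw [← ENat.natCast_inj, hm.1 t ht, hn.1 t ht]] at hd
    exact ⟨i, m ⊔ n, hm.sup hn, hd.unique (hB.isDiagProj i _)⟩
  · rw [Set.inter_eq_left.2 (hn.projSupp_subset hm hij)] at hd
    exact ⟨i, m, hm, hd.unique (hB.isDiagProj i m)⟩

lemma LeastInf.exists_projSupp_subset_iff {ℓ : ℕ} {k : Fin ℓ → ℕ∞} {r : ℕ}
    (hr : LeastInf ℓ k r) (i : Fin (ℓ + 1)) (m : Fin ℓ → ℕ) :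
    (∃ u : Fin ℓ → ℕ, (∀ j : Fin ℓ, (j : ℕ) < r → (u j : ℕ∞) = k j) ∧
      projSupp ⟨r, Nat.lt_succ_of_le hr.1⟩ u ⊆ projSupp i m) ↔ PointMem k i m := by
  constructor
  · rintro ⟨u, hu, hsub⟩
    have hui := hsub (self_mem_projSupp _ u)
    have hir : (i : ℕ) ≤ r := by
      by_contra! hlt
      have hrl : r < ℓ := by omega
      have h1 : Function.update u ⟨r, hrl⟩ (u ⟨r, hrl⟩ + 1) ∈
          projSupp ⟨r, Nat.lt_succ_of_le hr.1⟩ u := by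
        refine ⟨fun j hj => Function.update_of_ne ?_ _ _, fun j hj => ?_⟩
        · rintro rfl
          exact absurd hj (lt_irrefl _)
        · obtain rfl : j = ⟨r, hrl⟩ := Fin.ext (congrArg (fun t : Fin (ℓ + 1) => (t : ℕ)) hj)
          simp
      have h2 := (hsub h1).1 ⟨r, hrl⟩ hlt
      have h3 := hui.1 ⟨r, hrl⟩ hlt
      rw [Function.update_self] at h2
      omega
    refine ⟨fun j hj => ?_, fun j hj => ?_⟩
    · rw [← hui.1 j hj]
      exact hu j (lt_of_lt_of_le hj hir)
    · have hji : (j : ℕ) = i := congrArg Fin.val hj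
      rcases hir.lt_or_eq with hlt | heq
      · rw [← hu j (hji ▸ hlt), ENat.natCast_le_natCast]
        exact hui.2 j hj
      · have hrl : r < ℓ := by omega
        obtain rfl : j = ⟨r, hrl⟩ := Fin.ext (hji.trans heq)
        rw [hr.2.1 hrl]
        exact le_top
  · intro h
    have hir : (i : ℕ) ≤ r := by
      by_contra! hlt
      have hrl : r < ℓ := by omega
      exact ENat.natCast_ne_top _ ((h.1 ⟨r, hrl⟩ hlt).trans (hr.2.1 hrl))
    obtain ⟨u, hur, hum⟩ : ∃ u : Fin ℓ → ℕ, (∀ j : Fin ℓ, (j : ℕ) < r → (u j : ℕ∞) = k j) ∧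
        ∀ j : Fin ℓ, ¬ (j : ℕ) < r → u j = m j :=
      ⟨fun j => if (j : ℕ) < r then (k j).toNat else m j,
        fun j hj => by simpa [hj] using ENat.natCast_toNat (hr.2.2 j hj),
        fun j hj => if_neg hj⟩
    refine ⟨u, hur, fun a ha => ⟨fun j hj => ?_, fun j hj => ?_⟩⟩
    · have hjr : (j : ℕ) < r := lt_of_lt_of_le hj hir
      rw [ha.1 j hjr, ← ENat.natCast_inj, hur j hjr, h.1 j hj]
    · have hji : (j : ℕ) = i := congrArg Fin.val hj
      rcases hir.lt_or_eq with hlt | heq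
      · have hjr : (j : ℕ) < r := hji ▸ hlt
        rw [ha.1 j hjr, ← ENat.natCast_le_natCast, hur j hjr]
        exact h.2 j hj
      · rw [← hum j (by omega)]
        exact ha.2 j (Fin.ext (hji.trans heq))

/-- For `k ∈ ℕ̄^ℓ` with `r` the least index with `k_{r+1} = ∞` (convention
`k_{ℓ+1} = ∞`), let `Λ_k = {p_{r+1}(u) : π_r(u) = π_r(k)}` and
`A_{Λ_k} = {f ∈ E : f ≥ e for some e ∈ Λ_k}`.  Then `A_{Λ_k}` is a filter in `E`,
and membership is given by the closed formula: for paper indices `i ≤ ℓ`,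
`p_i(m) ∈ A_{Λ_k}` iff `π_{i−1}(m) = π_{i−1}(k)` and `m_i ≤ k_i`; and
`p_{ℓ+1}(m) ∈ A_{Λ_k}` iff `m = k`. -/
theorem filter_of_point (ℓ : ℕ) (hℓ : 1 ≤ ℓ)
    (B : Fin (ℓ + 1) → ℤ → (Fin ℓ → ℕ) → (Fin ℓ → ℕ) → (H ℓ →L[ℂ] H ℓ))
    (hB : IsBop ℓ B) (k : Fin ℓ → ℕ∞) (r : ℕ) (hr : LeastInf ℓ k r)
    (Lam A : Set (H ℓ →L[ℂ] H ℓ))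
    (hLam : Lam = {x | ∃ u : Fin ℓ → ℕ,
        (∀ j : Fin ℓ, (j : ℕ) < r → (u j : ℕ∞) = k j) ∧
        x = B ⟨r, Nat.lt_succ_of_le hr.1⟩ 0 u u})
    (hA : A = {f | f ∈ Eset ℓ B ∧ ∃ e ∈ Lam, e ≤ f}) :
    IsFilterIn ℓ B A ∧
    (∀ (i : Fin ℓ) (m : Fin ℓ → ℕ),
      B i.castSucc 0 m m ∈ A ↔
        (∀ j : Fin ℓ, j < i → (m j : ℕ∞) = k j) ∧ (m i : ℕ∞) ≤ k i) ∧
    (∀ m : Fin ℓ → ℕ,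
      B (Fin.last ℓ) 0 m m ∈ A ↔ ∀ j : Fin ℓ, (m j : ℕ∞) = k j) := by
  subst hLam hA
  have hmem : ∀ i m, B i 0 m m ∈ {f | f ∈ Eset ℓ B ∧ ∃ e ∈ {x | ∃ u : Fin ℓ → ℕ,
      (∀ j : Fin ℓ, (j : ℕ) < r → (u j : ℕ∞) = k j) ∧
      x = B ⟨r, Nat.lt_succ_of_le hr.1⟩ 0 u u}, e ≤ f} ↔ PointMem k i m := by
    intro i m
    rw [← hr.exists_projSupp_subset_iff]
    constructor
    · rintro ⟨-, _, ⟨u, hu, rfl⟩, hle⟩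
      exact ⟨u, hu, ((hB.isDiagProj _ _).le_iff (hB.isDiagProj _ _)).1 hle⟩
    · rintro ⟨u, hu, hsub⟩
      exact ⟨Or.inr ⟨i, m, rfl⟩, _, ⟨u, hu, rfl⟩,
        ((hB.isDiagProj _ _).le_iff (hB.isDiagProj _ _)).2 hsub⟩
  have hzero : (0 : H ℓ →L[ℂ] H ℓ) ∉ {f | f ∈ Eset ℓ B ∧ ∃ e ∈ {x | ∃ u : Fin ℓ → ℕ,
      (∀ j : Fin ℓ, (j : ℕ) < r → (u j : ℕ∞) = k j) ∧
      x = B ⟨r, Nat.lt_succ_of_le hr.1⟩ 0 u u}, e ≤ f} := by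
    rintro ⟨-, _, ⟨u, -, rfl⟩, hle⟩
    exact ((hB.isDiagProj _ _).le_iff IsDiagProj.zero).1 hle (self_mem_projSupp _ u)
  refine ⟨⟨?_, fun f hf => hf.1, hzero, ?_, ?_⟩, fun i m => ?_, fun m => ?_⟩
  · have hk : ∀ j : Fin ℓ, (j : ℕ) < r → ((k j).toNat : ℕ∞) = k j :=
      fun j hj => ENat.natCast_toNat (hr.2.2 j hj)
    exact ⟨_, Or.inr ⟨_, _, rfl⟩, _, ⟨fun j => (k j).toNat, hk, rfl⟩, le_rfl⟩
  · intro e he f hf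
    rcases he.1 with rfl | ⟨i, m, rfl⟩
    · exact absurd he hzero
    rcases hf.1 with rfl | ⟨j, n, rfl⟩
    · exact absurd hf hzero
    obtain ⟨t, u, htu, hmul⟩ := ((hmem i m).1 he).exists_mul hB ((hmem j n).1 hf)
    rw [hmul]
    exact (hmem t u).2 htu
  · rintro e ⟨-, e', he', hle⟩ f hf hef
    exact ⟨hf, e', he', hle.trans hef⟩
  · rw [hmem]
    simp [PointMem]
  · rw [hmem]
    simp [PointMem, Fin.castSucc_lt_last, (Fin.castSucc_lt_last _).ne]
end
end

section
/- The set Ê_∞ := {φ(k) : k ∈ \bar{ℕ}^ℓ} ⊆ {0,1}^E is compact, and it is closed in the space Ê₀ of characters of E; consequently the closure Ê_tight of Ê_∞ in Ê₀ equals Ê_∞. -/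
open scoped BigOperators

noncomputable section

/-- The finite truncation of `k` at height `N`: infinite coordinates are replaced by `N`. -/
def truncTop {ℓ : ℕ} (k : Fin ℓ → ℕ∞) (N : ℕ) (j : Fin ℓ) : ℕ :=
  if k j = ⊤ then N else (k j).toNat

lemma eventually_eq_truncTop_iff {ℓ : ℕ} (k : Fin ℓ → ℕ∞) (j : Fin ℓ) (n : ℕ) :
    (∀ᶠ N in Filter.atTop, truncTop k N j = n) ↔ (n : ℕ∞) = k j := by
  unfold truncTop
  by_cases h : k j = ⊤
  · simp only [h, if_true, Filter.eventually_atTop]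
    refine iff_of_false ?_ (ENat.natCast_ne_top n)
    rintro ⟨a, ha⟩
    have h₁ := ha (a + n + 1) (by omega)
    omega
  · obtain ⟨c, hc⟩ := ENat.ne_top_iff_exists.mp h
    simp only [← hc, ENat.natCast_ne_top, if_false, ENat.toNat_natCast, Filter.eventually_const,
      Nat.cast_inj, eq_comm]

lemma eventually_le_truncTop_iff {ℓ : ℕ} (k : Fin ℓ → ℕ∞) (j : Fin ℓ) (n : ℕ) :
    (∀ᶠ N in Filter.atTop, n ≤ truncTop k N j) ↔ (n : ℕ∞) ≤ k j := by
  unfold truncTop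
  by_cases h : k j = ⊤
  · simpa [h] using ⟨n, fun b hb => hb⟩
  · obtain ⟨c, hc⟩ := ENat.ne_top_iff_exists.mp h
    simp only [← hc, ENat.natCast_ne_top, if_false, ENat.toNat_natCast, Filter.eventually_const,
      Nat.cast_le]

lemma basisVec_ne_zero (ℓ : ℕ) (a : Fin ℓ → ℕ) (z : ℤ) : basisVec ℓ a z ≠ 0 := by
  intro h
  have h₁ := congrArg (fun v : H ℓ => v (a, z)) h
  simp [basisVec] at h₁

lemma phi_eq_true_iff {ℓ : ℕ}
    (B : Fin (ℓ + 1) → ℤ → (Fin ℓ → ℕ) → (Fin ℓ → ℕ) → (H ℓ →L[ℂ] H ℓ)) (k : Fin ℓ → ℕ∞)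
    (e : {e : H ℓ →L[ℂ] H ℓ // e ∈ Eset ℓ B}) :
    phi ℓ B k e = true ↔ e.val ∈ phiSupp ℓ B k := by
  simp [phi]

namespace IsBop

variable {ℓ : ℕ} {B : Fin (ℓ + 1) → ℤ → (Fin ℓ → ℕ) → (Fin ℓ → ℕ) → (H ℓ →L[ℂ] H ℓ)}

lemma castSucc_apply (hB : IsBop ℓ B) (i : Fin ℓ) (m a : Fin ℓ → ℕ) :
    B i.castSucc 0 m m (basisVec ℓ a 0) =
      if (∀ j, j < i → a j = m j) ∧ m i ≤ a i then basisVec ℓ a 0 else 0 := by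
  rw [hB.1]
  refine ite_congr rfl (fun h => ?_) fun _ => rfl
  congr 1
  · funext j
    split_ifs with h₁ h₂
    · exact (h.1 j h₁).symm
    · subst h₂
      exact Nat.sub_add_cancel h.2
    · rfl
  · simp

lemma last_apply (hB : IsBop ℓ B) (m a : Fin ℓ → ℕ) :
    B (Fin.last ℓ) 0 m m (basisVec ℓ a 0) = if a = m then basisVec ℓ a 0 else 0 := by
  rw [hB.2]
  refine ite_congr rfl (fun h => ?_) fun _ => rfl
  simp [h]

lemma castSucc_apply_eq_self_iff (hB : IsBop ℓ B) (i : Fin ℓ) (m a : Fin ℓ → ℕ) :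
    B i.castSucc 0 m m (basisVec ℓ a 0) = basisVec ℓ a 0 ↔
      (∀ j, j < i → a j = m j) ∧ m i ≤ a i := by
  rw [hB.castSucc_apply, ite_eq_left_iff]
  exact ⟨fun h => by_contra fun hn => basisVec_ne_zero ℓ a 0 (h hn).symm, fun h hn => (hn h).elim⟩

lemma last_apply_eq_self_iff (hB : IsBop ℓ B) (m a : Fin ℓ → ℕ) :
    B (Fin.last ℓ) 0 m m (basisVec ℓ a 0) = basisVec ℓ a 0 ↔ a = m := by
  rw [hB.last_apply, ite_eq_left_iff]
  exact ⟨fun h => by_contra fun hn => basisVec_ne_zero ℓ a 0 (h hn).symm, fun h hn => (hn h).elim⟩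

lemma eventually_castSucc_iff (hB : IsBop ℓ B) (i : Fin ℓ) (m : Fin ℓ → ℕ) (k : Fin ℓ → ℕ∞) :
    (∀ᶠ N in Filter.atTop, B i.castSucc 0 m m (basisVec ℓ (truncTop k N) 0) =
        basisVec ℓ (truncTop k N) 0) ↔
      (∀ j, j < i → (m j : ℕ∞) = k j) ∧ (m i : ℕ∞) ≤ k i := by
  simp only [hB.castSucc_apply_eq_self_iff, Filter.eventually_and, Filter.eventually_all,
    eventually_eq_truncTop_iff, eventually_le_truncTop_iff]

lemma eventually_last_iff (hB : IsBop ℓ B) (m : Fin ℓ → ℕ) (k : Fin ℓ → ℕ∞) :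
    (∀ᶠ N in Filter.atTop, B (Fin.last ℓ) 0 m m (basisVec ℓ (truncTop k N) 0) =
        basisVec ℓ (truncTop k N) 0) ↔ ∀ j, (m j : ℕ∞) = k j := by
  simp only [hB.last_apply_eq_self_iff, funext_iff, Filter.eventually_all,
    eventually_eq_truncTop_iff]

/-- `φ(k)` is the pointwise limit of evaluation at the truncations of `k`. -/
lemma mem_phiSupp_iff (hB : IsBop ℓ B) {e : H ℓ →L[ℂ] H ℓ} (he : e ∈ Eset ℓ B)
    (k : Fin ℓ → ℕ∞) :
    e ∈ phiSupp ℓ B k ↔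
      ∀ᶠ N in Filter.atTop, e (basisVec ℓ (truncTop k N) 0) = basisVec ℓ (truncTop k N) 0 := by
  constructor
  · rintro (⟨i, m, rfl, h⟩ | ⟨m, rfl, h⟩)
    · exact (hB.eventually_castSucc_iff i m k).2 h
    · exact (hB.eventually_last_iff m k).2 h
  · intro h
    rcases he with he | ⟨i, m, rfl⟩
    · obtain ⟨N, hN⟩ := h.exists
      rw [Set.mem_singleton_iff.mp he] at hN
      exact (basisVec_ne_zero _ _ _ hN.symm).elim
    · induction i using Fin.lastCases with
      | last => exact Or.inr ⟨m, rfl, (hB.eventually_last_iff m k).1 h⟩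
      | cast i => exact Or.inl ⟨i, m, rfl, (hB.eventually_castSucc_iff i m k).1 h⟩

lemma zero_notMem_phiSupp (hB : IsBop ℓ B) (k : Fin ℓ → ℕ∞) : 0 ∉ phiSupp ℓ B k := by
  rw [hB.mem_phiSupp_iff (Or.inl rfl)]
  intro h
  obtain ⟨N, hN⟩ := h.exists
  exact basisVec_ne_zero _ _ _ hN.symm

lemma apply_eq_self_or_zero (hB : IsBop ℓ B) {e : H ℓ →L[ℂ] H ℓ} (he : e ∈ Eset ℓ B)
    (a : Fin ℓ → ℕ) :
    e (basisVec ℓ a 0) = basisVec ℓ a 0 ∨ e (basisVec ℓ a 0) = 0 := by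
  rcases he with he | ⟨i, m, rfl⟩
  · rw [Set.mem_singleton_iff.mp he]
    exact Or.inr rfl
  · induction i using Fin.lastCases with
    | last => rw [hB.last_apply]; exact ite_eq_or_eq _ _ _
    | cast i => rw [hB.castSucc_apply]; exact ite_eq_or_eq _ _ _

lemma mul_apply_eq_self_iff (hB : IsBop ℓ B) {e f : H ℓ →L[ℂ] H ℓ} (hf : f ∈ Eset ℓ B)
    (a : Fin ℓ → ℕ) :
    (e * f) (basisVec ℓ a 0) = basisVec ℓ a 0 ↔
      e (basisVec ℓ a 0) = basisVec ℓ a 0 ∧ f (basisVec ℓ a 0) = basisVec ℓ a 0 := by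
  rw [mul_apply_eq_comp]
  rcases hB.apply_eq_self_or_zero hf a with h | h
  · simp [h]
  · simp [h, (basisVec_ne_zero ℓ a 0).symm]

lemma isCharacter_phi (hB : IsBop ℓ B) (hℓ : 1 ≤ ℓ) (k : Fin ℓ → ℕ∞) :
    IsCharacter ℓ B (phi ℓ B k) := by
  refine ⟨⟨⟨B (Fin.castSucc ⟨0, hℓ⟩) 0 0 0, Or.inr ⟨_, _, rfl⟩⟩, ?_⟩, ?_, ?_⟩
  · refine (phi_eq_true_iff _ _ _).2 (Or.inl ⟨⟨0, hℓ⟩, 0, rfl, fun j hj => ?_, ?_⟩)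
    · exact absurd hj (Nat.not_lt_zero _)
    · simp
  · rintro ⟨e, he⟩ ⟨f, hf⟩ h
    rw [Bool.eq_iff_iff, Bool.and_eq_true]
    simp only [phi_eq_true_iff]
    rw [hB.mem_phiSupp_iff h, hB.mem_phiSupp_iff he, hB.mem_phiSupp_iff hf,
      ← Filter.eventually_and]
    simp only [hB.mul_apply_eq_self_iff hf]
  · exact fun _ => Bool.eq_false_iff.2 fun h =>
      hB.zero_notMem_phiSupp k ((phi_eq_true_iff _ _ _).1 h)

end IsBop

lemma isClopen_setOf_natCast_eq (n : ℕ) : IsClopen {x : ℕ∞ | (n : ℕ∞) = x} := by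
  have h : {x : ℕ∞ | (n : ℕ∞) = x} = {(n : ℕ∞)} := by
    ext x
    exact eq_comm
  rw [h]
  exact ⟨isClosed_singleton, ENat.isOpen_singleton (ENat.natCast_ne_top n)⟩

lemma isClopen_setOf_natCast_le (n : ℕ) : IsClopen {x : ℕ∞ | (n : ℕ∞) ≤ x} := by
  refine ⟨isClosed_Ici, ?_⟩
  cases n with
  | zero => simp
  | succ n =>
    have h : {x : ℕ∞ | ((n + 1 : ℕ) : ℕ∞) ≤ x} = Set.Ioi (n : ℕ∞) := by
      ext x
      simpa using ENat.add_one_le_iff (ENat.natCast_ne_top n)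
    rw [h]
    exact isOpen_Ioi

lemma IsBop.continuous_phi {ℓ : ℕ}
    {B : Fin (ℓ + 1) → ℤ → (Fin ℓ → ℕ) → (Fin ℓ → ℕ) → (H ℓ →L[ℂ] H ℓ)} (hB : IsBop ℓ B) :
    Continuous (phi ℓ B) := by
  refine continuous_pi fun ⟨e, he⟩ => (continuous_bool_rng true).2 ?_
  have hpre : (fun k => phi ℓ B k ⟨e, he⟩) ⁻¹' {true} = {k | e ∈ phiSupp ℓ B k} := by
    ext k
    exact phi_eq_true_iff B k ⟨e, he⟩
  rw [hpre]
  rcases he with h0 | ⟨i, m, rfl⟩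
  · rw [Set.mem_singleton_iff.mp h0]
    simp [hB.zero_notMem_phiSupp, isClopen_empty]
  · have hEq (j : Fin ℓ) : IsClopen {k : Fin ℓ → ℕ∞ | (m j : ℕ∞) = k j} :=
      (isClopen_setOf_natCast_eq (m j)).preimage (continuous_apply j)
    induction i using Fin.lastCases with
    | last =>
      simp only [hB.mem_phiSupp_iff (Or.inr ⟨_, _, rfl⟩), hB.eventually_last_iff, Set.ofPred_forall]
      exact isClopen_iInter_of_finite hEq
    | cast i =>
      simp only [hB.mem_phiSupp_iff (Or.inr ⟨_, _, rfl⟩), hB.eventually_castSucc_iff,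
        Set.ofPred_and, Set.ofPred_forall]
      exact (isClopen_iInter_of_finite fun j => isClopen_iInter_of_finite fun _ => hEq j).inter
        ((isClopen_setOf_natCast_le (m i)).preimage (continuous_apply i))

/-- `Ê_∞ = {φ(k) : k ∈ ℕ̄^ℓ}` is a compact subset of `{0,1}^E`, and it is closed in
the set `Ê₀` of characters (i.e. its closure meets `Ê₀` only in itself); hence
`Ê_tight`, the closure of `Ê_∞` in `Ê₀`, equals `Ê_∞`. -/
theorem Einf_compact_closed (ℓ : ℕ) (hℓ : 1 ≤ ℓ)
    (B : Fin (ℓ + 1) → ℤ → (Fin ℓ → ℕ) → (Fin ℓ → ℕ) → (H ℓ →L[ℂ] H ℓ))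
    (hB : IsBop ℓ B) :
    IsCompact (Set.range (phi ℓ B)) ∧
    closure (Set.range (phi ℓ B)) ∩
        {x : {e : H ℓ →L[ℂ] H ℓ // e ∈ Eset ℓ B} → Bool | IsCharacter ℓ B x} =
      Set.range (phi ℓ B) := by
  have hc : IsCompact (Set.range (phi ℓ B)) := isCompact_range hB.continuous_phi
  refine ⟨hc, ?_⟩
  rw [hc.isClosed.closure_eq, Set.inter_eq_left]
  rintro _ ⟨k, rfl⟩
  exact hB.isCharacter_phi hℓ k
end
end
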